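/- If κ is μ-measurable, that is, if there is an elementary embedding j : V → M with critical point κ such that the induced normal measure μ = {X ⊆ κ : κ ∈ j(X)} is an element of M, then LD^meas_κ holds. -/

import Mathlib

open FirstOrder

universe u

namespace LaverDiamond

/-- The relation symbols of the language of set theory: a single binary relation `mem`. -/
inductive memRel : ℕ → Type
  | mem : memRel 2

/-- The first-order language of set theory. -/
def SetLang : FirstOrder.Language := ⟨fun _ => Empty, memRel⟩

/-- Any class of ZF-sets is a structure in the language of set theory, with the true
membership relation. -/
instance classStructure (M : Set ZFSet.{u}) : SetLang.Structure M where
  funMap := fun {_} f _ => f.elim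
  RelMap := fun {_} r x => match r with
    | .mem => (x 0 : ZFSet) ∈ (x 1 : ZFSet)

/-- A (fully) elementary embedding from the class `M` to the class `N`, both classes of
ZF-sets equipped with the true membership relation.  It is coded by a global function
`j : ZFSet → ZFSet` mapping `M` into `N`, elementary for all first-order formulas
with parameters from `M`. -/
structure ClassEmb (M N : Set ZFSet.{u}) where
  j : ZFSet.{u} → ZFSet.{u}
  maps : ∀ x, x ∈ M → j x ∈ N
  elem : ∀ {n : ℕ} (φ : SetLang.Formula (Fin n)) (v : Fin n → ZFSet.{u}) (hv : ∀ i, v i ∈ M),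
    φ.Realize (fun i => (⟨v i, hv i⟩ : M)) ↔ φ.Realize (fun i => (⟨j (v i), maps _ (hv i)⟩ : N))

/-- The universe of all ZF-sets, as a class. -/
def V : Set ZFSet.{u} := Set.univ

/-- A transitive class of ZF-sets. -/
def TransClass (M : Set ZFSet.{u}) : Prop := ∀ x ∈ M, ∀ y ∈ x, y ∈ M

/-- `j` has critical point `κ`: `κ` is an ordinal, fixed below `κ`, with `j(κ) > κ`. -/
def CritPt (j : ZFSet.{u} → ZFSet.{u}) (κ : ZFSet.{u}) : Prop :=
  κ.IsOrdinal ∧ κ ∈ j κ ∧ ∀ α : ZFSet, α.IsOrdinal → α ∈ κ → j α = α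

/-- `x` is a member of the rank-initial segment `V_θ`. -/
def MemV (θ x : ZFSet.{u}) : Prop := x.rank < θ.rank

/-- `κ` is a cardinal: an ordinal not equinumerous with any smaller ordinal. -/
def IsCard (κ : ZFSet.{u}) : Prop :=
  κ.IsOrdinal ∧ ∀ β ∈ κ, Cardinal.mk β.toSet < Cardinal.mk κ.toSet

/-- `x ∈ H(θ⁺)`, i.e. `x` has hereditary size at most `θ`. -/
def MemH (θ x : ZFSet.{u}) : Prop :=
  ∃ t : ZFSet, t.IsTransitive ∧ x ∈ t ∧ Cardinal.mk t.toSet ≤ Cardinal.mk θ.toSet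

/-- `f` is a set-function with domain `θ` taking values in the class `M`. -/
def IsFuncInto (θ : ZFSet.{u}) (M : Set ZFSet.{u}) (f : ZFSet.{u}) : Prop :=
  (∀ p ∈ f, ∃ a b : ZFSet, a ∈ θ ∧ b ∈ M ∧ p = ZFSet.pair a b) ∧
  ∀ a ∈ θ, ∃! b : ZFSet, ZFSet.pair a b ∈ f

/-- The class `M` is closed under `θ`-sequences: `M^θ ⊆ M`. -/
def SeqClosed (θ : ZFSet.{u}) (M : Set ZFSet.{u}) : Prop :=
  ∀ f : ZFSet, IsFuncInto θ M f → f ∈ M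

/-- The set `M` is closed under `<κ`-sequences: `M^{<κ} ⊆ M`. -/
def SeqClosedLt (κ M : ZFSet.{u}) : Prop :=
  ∀ α : ZFSet, α ∈ κ → ∀ f : ZFSet, IsFuncInto α M.toSet f → f ∈ M

/-- `ℓ` is a partial function from `κ` to `V_κ` (coded as a set of Kuratowski pairs). -/
def IsPFun (κ ℓ : ZFSet.{u}) : Prop :=
  (∀ p ∈ ℓ, ∃ γ A : ZFSet, γ ∈ κ ∧ MemV κ A ∧ p = ZFSet.pair γ A) ∧
  ∀ γ A B : ZFSet, ZFSet.pair γ A ∈ ℓ → ZFSet.pair γ B ∈ ℓ → A = B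

/-- The set `r` is the restriction to `κ` of the class function `ℓ` (defined on the
ordinals below `κ`), coded as a set of Kuratowski pairs. -/
def RestrictEq (ℓ : ZFSet.{u} → ZFSet.{u}) (κ r : ZFSet.{u}) : Prop :=
  ∀ p : ZFSet, p ∈ r ↔ ∃ γ : ZFSet, γ ∈ κ ∧ p = ZFSet.pair γ (ℓ γ)

/-- The set `r` is the restriction to `κ` of the class function `ℓ` restricted further to
the class `D`. -/
def RestrictEqOn (ℓ : ZFSet.{u} → ZFSet.{u}) (D : Set ZFSet.{u}) (κ r : ZFSet.{u}) : Prop :=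
  ∀ p : ZFSet, p ∈ r ↔ ∃ γ : ZFSet, γ ∈ κ ∧ γ ∈ D ∧ p = ZFSet.pair γ (ℓ γ)

/-- The set `r` is the restriction to `δ` of the set partial function `ℓ`. -/
def RestrictSet (ℓ δ r : ZFSet.{u}) : Prop :=
  ∀ p : ZFSet, p ∈ r ↔ p ∈ ℓ ∧ ∃ γ A : ZFSet, γ ∈ δ ∧ p = ZFSet.pair γ A

/-! ### Supercompactness -/

/-- A `θ`-supercompactness embedding with critical point `κ`: an elementary embedding
`j : V → M` with `M` a transitive class closed under `θ`-sequences and `j(κ) > θ`. -/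
structure SCEmb (κ θ : ZFSet.{u}) where
  M : Set ZFSet.{u}
  trans : TransClass M
  e : ClassEmb V M
  crit : CritPt e.j κ
  closed : SeqClosed θ M
  big : θ ∈ e.j κ

/-- `κ` is `θ`-supercompact. -/
def SCAt (κ θ : ZFSet.{u}) : Prop := Nonempty (SCEmb κ θ)

/-- `κ` is supercompact: `θ`-supercompact for every cardinal `θ`. -/
def Supercompact (κ : ZFSet.{u}) : Prop := ∀ θ : ZFSet, IsCard θ → SCAt κ θ

/-- `ℓ` is a Laver function witnessing the Laver diamond `LD^sc_κ`. -/
def LDscFun (κ ℓ : ZFSet.{u}) : Prop :=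
  IsPFun κ ℓ ∧ ∀ θ A : ZFSet, IsCard θ → MemH θ A →
    ∃ E : SCEmb κ θ, ZFSet.pair κ A ∈ E.e.j ℓ

/-- The Laver diamond principle `LD^sc_κ`. -/
def LDsc (κ : ZFSet.{u}) : Prop := ∃ ℓ : ZFSet, LDscFun κ ℓ

/-- A universal `LD^sc` Laver function. -/
def UnivLDsc (ℓ : ZFSet.{u} → ZFSet.{u}) : Prop :=
  ∀ κ : ZFSet, Supercompact κ → ∃ r : ZFSet, RestrictEq ℓ κ r ∧ LDscFun κ r

/-! ### Strongness -/

/-- A `θ`-strongness embedding with critical point `κ`: an elementary `j : V → M` with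
`M` a transitive class and `V_θ ⊆ M`. -/
structure StrEmb (κ θ : ZFSet.{u}) where
  M : Set ZFSet.{u}
  trans : TransClass M
  e : ClassEmb V M
  crit : CritPt e.j κ
  vsub : ∀ x : ZFSet, MemV θ x → x ∈ M

/-- `κ` is `θ`-strong. -/
def StrongAt (κ θ : ZFSet.{u}) : Prop := Nonempty (StrEmb κ θ)

/-- `κ` is a strong cardinal. -/
def Strong (κ : ZFSet.{u}) : Prop := ∀ θ : ZFSet, θ.IsOrdinal → StrongAt κ θ

/-- `ℓ` witnesses the Laver diamond `LD^strong_κ`. -/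
def LDstrongFun (κ ℓ : ZFSet.{u}) : Prop :=
  IsPFun κ ℓ ∧ ∀ θ A : ZFSet, θ.IsOrdinal → MemV θ A →
    ∃ E : StrEmb κ θ, ZFSet.pair κ A ∈ E.e.j ℓ

/-- The Laver diamond principle `LD^strong_κ`. -/
def LDstrong (κ : ZFSet.{u}) : Prop := ∃ ℓ : ZFSet, LDstrongFun κ ℓ

/-- A universal `LD^strong` Laver function. -/
def UnivLDstrong (ℓ : ZFSet.{u} → ZFSet.{u}) : Prop :=
  ∀ κ : ZFSet, Strong κ → ∃ r : ZFSet, RestrictEq ℓ κ r ∧ LDstrongFun κ r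

/-! ### Measurability -/

/-- An embedding witnessing measurability of `κ`: an elementary `j : V → M`
with `M` a transitive class and critical point `κ`. -/
structure MeasEmb (κ : ZFSet.{u}) where
  M : Set ZFSet.{u}
  trans : TransClass M
  e : ClassEmb V M
  crit : CritPt e.j κ

/-- `κ` is a measurable cardinal. -/
def MeasurableCard (κ : ZFSet.{u}) : Prop := Nonempty (MeasEmb κ)

/-- `ℓ` witnesses the Laver diamond `LD^meas_κ`. -/
def LDmeasFun (κ ℓ : ZFSet.{u}) : Prop :=
  IsPFun κ ℓ ∧ ∀ A : ZFSet, MemH κ A → ∃ E : MeasEmb κ, ZFSet.pair κ A ∈ E.e.j ℓ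

/-- The Laver diamond principle `LD^meas_κ`. -/
def LDmeas (κ : ZFSet.{u}) : Prop := ∃ ℓ : ZFSet, LDmeasFun κ ℓ

/-- A universal `LD^meas` Laver function. -/
def UnivLDmeas (ℓ : ZFSet.{u} → ZFSet.{u}) : Prop :=
  ∀ κ : ZFSet, MeasurableCard κ → ∃ r : ZFSet, RestrictEq ℓ κ r ∧ LDmeasFun κ r

/-! ### Weak compactness -/

/-- `κ` is weakly compact: every transitive set `M` of size `κ` with `κ ∈ M` admits an
elementary embedding `j : M → N` into a transitive set `N` with critical point `κ`. -/
def WeaklyCompact (κ : ZFSet.{u}) : Prop :=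
  ∀ M : ZFSet, M.IsTransitive → Cardinal.mk M.toSet = Cardinal.mk κ.toSet → κ ∈ M →
    ∃ N : ZFSet, N.IsTransitive ∧ ∃ e : ClassEmb M.toSet N.toSet, CritPt e.j κ

/-- `ℓ` witnesses the Laver diamond `LD^wc_κ`. -/
def LDwcFun (κ ℓ : ZFSet.{u}) : Prop :=
  IsPFun κ ℓ ∧ ∀ A M : ZFSet, MemH κ A →
    M.IsTransitive → Cardinal.mk M.toSet = Cardinal.mk κ.toSet → κ ∈ M → A ∈ M → ℓ ∈ M →
    ∃ N : ZFSet, N.IsTransitive ∧ ∃ e : ClassEmb M.toSet N.toSet,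
      CritPt e.j κ ∧ ZFSet.pair κ A ∈ e.j ℓ

/-- The Laver diamond principle `LD^wc_κ`. -/
def LDwc (κ : ZFSet.{u}) : Prop := ∃ ℓ : ZFSet, LDwcFun κ ℓ

/-- A universal `LD^wc` Laver function. -/
def UnivLDwc (ℓ : ZFSet.{u} → ZFSet.{u}) : Prop :=
  ∀ κ : ZFSet, WeaklyCompact κ → ∃ r : ZFSet, RestrictEq ℓ κ r ∧ LDwcFun κ r

/-! ### Nice structures and unfoldability -/

/-- `M` is a nice structure for `κ`: a transitive set of size `κ`, closed under
`<κ`-sequences, with `κ ∈ M`. -/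
def Nice (κ M : ZFSet.{u}) : Prop :=
  M.IsTransitive ∧ Cardinal.mk M.toSet = Cardinal.mk κ.toSet ∧ SeqClosedLt κ M ∧ κ ∈ M

/-- `κ` is unfoldable: for every ordinal `θ`, every nice structure admits a
`θ`-unfoldability embedding. -/
def Unfoldable (κ : ZFSet.{u}) : Prop :=
  ∀ θ M : ZFSet, θ.IsOrdinal → Nice κ M →
    ∃ N : ZFSet, N.IsTransitive ∧ ∃ e : ClassEmb M.toSet N.toSet, CritPt e.j κ ∧ θ ∈ e.j κ

/-- `ℓ` witnesses the Laver diamond `LD^unf_κ`. -/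
def LDunfFun (κ ℓ : ZFSet.{u}) : Prop :=
  IsPFun κ ℓ ∧ ∀ θ A M : ZFSet, θ.IsOrdinal → MemH κ A →
    M.IsTransitive → Cardinal.mk M.toSet = Cardinal.mk κ.toSet → SeqClosedLt κ M →
    κ ∈ M → ℓ ∈ M → A ∈ M →
    ∃ N : ZFSet, N.IsTransitive ∧ ∃ e : ClassEmb M.toSet N.toSet,
      CritPt e.j κ ∧ θ ∈ e.j κ ∧ ZFSet.pair κ A ∈ e.j ℓ

/-- The Laver diamond principle `LD^unf_κ`. -/
def LDunf (κ : ZFSet.{u}) : Prop := ∃ ℓ : ZFSet, LDunfFun κ ℓ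

/-- `ℓ` witnesses the Laver diamond `LD^sunf_κ` for strong unfoldability. -/
def LDsunfFun (κ ℓ : ZFSet.{u}) : Prop :=
  IsPFun κ ℓ ∧ ∀ θ A M : ZFSet, IsCard θ → MemH θ A →
    M.IsTransitive → Cardinal.mk M.toSet = Cardinal.mk κ.toSet → SeqClosedLt κ M →
    κ ∈ M → ℓ ∈ M →
    ∃ N : ZFSet, N.IsTransitive ∧ (∀ x : ZFSet, MemV θ x → x ∈ N) ∧
      ∃ e : ClassEmb M.toSet N.toSet, CritPt e.j κ ∧ θ ∈ e.j κ ∧ ZFSet.pair κ A ∈ e.j ℓ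

/-! ### Ramsey cardinals -/

/-- `F` is a weakly amenable `M`-normal measure on `κ`. -/
def MNormalMeasure (κ M F : ZFSet.{u}) : Prop :=
  (∀ X ∈ F, X ⊆ κ ∧ X ∈ M) ∧ κ ∈ F ∧ (∅ : ZFSet) ∉ F ∧
  (∀ X Y : ZFSet, X ∈ F → Y ∈ F → X ∩ Y ∈ F) ∧
  (∀ X Y : ZFSet, X ∈ F → Y ∈ M → X ⊆ Y → Y ⊆ κ → Y ∈ F) ∧
  (∀ X : ZFSet, X ∈ M → X ⊆ κ → (X ∈ F ∨ κ \ X ∈ F)) ∧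
  (∀ ξ ∈ κ, ({ξ} : ZFSet) ∉ F) ∧
  (∀ γ f : ZFSet, γ ∈ κ → f ∈ M → IsFuncInto γ F.toSet f →
    ZFSet.sep (fun ξ => ∀ a X : ZFSet, ZFSet.pair a X ∈ f → ξ ∈ X) κ ∈ F) ∧
  (∀ f : ZFSet, f ∈ M → IsFuncInto κ F.toSet f →
    ZFSet.sep (fun ξ => ∀ a X : ZFSet, ZFSet.pair a X ∈ f → a ∈ ξ → ξ ∈ X) κ ∈ F) ∧
  (∀ D : ZFSet, D ∈ M → MemH κ D → F ∩ D ∈ M)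

/-- `j` is (isomorphic to) the ultrapower map of `M` by the `M`-measure `F` on `κ`, with
transitive (wellfounded) target `N`: `j` is elementary, has critical point `κ`, derives the
measure `F` at `κ`, and every element of `N` has the form `j(f)(κ)` for some function
`f ∈ M` with domain `κ`. -/
def IsUltrapowerMap (κ M F N : ZFSet.{u}) (j : ZFSet.{u} → ZFSet.{u}) : Prop :=
  N.IsTransitive ∧ (∃ e : ClassEmb M.toSet N.toSet, e.j = j) ∧ CritPt j κ ∧
  (∀ X : ZFSet, X ∈ M → X ⊆ κ → (X ∈ F ↔ κ ∈ j X)) ∧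
  (∀ y ∈ N, ∃ f : ZFSet, f ∈ M ∧ (∀ a ∈ κ, ∃! b : ZFSet, ZFSet.pair a b ∈ f) ∧
    ZFSet.pair κ y ∈ j f)

/-- A wellfounded iteration of `⟨M, F⟩` of length `δ`: a commuting system of elementary
embeddings between transitive models, starting at `⟨M, F⟩`, taking ultrapowers by the
image measures at successor steps and direct limits at limit stages. -/
structure Iteration (κ M F δ : ZFSet.{u}) where
  Mod : ZFSet.{u} → ZFSet.{u}
  Meas : ZFSet.{u} → ZFSet.{u}
  cp : ZFSet.{u} → ZFSet.{u}
  emb : ZFSet.{u} → ZFSet.{u} → ZFSet.{u} → ZFSet.{u}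
  mod_zero : Mod ∅ = M
  meas_zero : Meas ∅ = F
  cp_zero : cp ∅ = κ
  trans' : ∀ i : ZFSet, i ∈ δ → (Mod i).IsTransitive
  elem' : ∀ i k : ZFSet, i ∈ δ → k ∈ δ → i ∈ k →
    ∃ e : ClassEmb (Mod i).toSet (Mod k).toSet, e.j = emb i k
  comm : ∀ i k l : ZFSet, i ∈ δ → k ∈ δ → l ∈ δ → i ∈ k → k ∈ l →
    ∀ x ∈ Mod i, emb k l (emb i k x) = emb i l x
  cp_emb : ∀ i : ZFSet, i ∈ δ → i ≠ ∅ → cp i = emb ∅ i κ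
  succ' : ∀ i : ZFSet, i ∈ δ → insert i i ∈ δ →
    IsUltrapowerMap (cp i) (Mod i) (Meas i) (Mod (insert i i)) (emb i (insert i i)) ∧
    (∀ Y : ZFSet, Y ∈ Meas (insert i i) ↔
      ∃ D : ZFSet, D ∈ Mod i ∧ Y ∈ emb i (insert i i) (Meas i ∩ D))
  limit' : ∀ l : ZFSet, l ∈ δ → l ≠ ∅ → (∀ i ∈ l, insert i i ∈ l) →
    (∀ y ∈ Mod l, ∃ i : ZFSet, i ∈ l ∧ ∃ x, x ∈ Mod i ∧ emb i l x = y) ∧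
    (∀ Y : ZFSet, Y ∈ Meas l ↔
      ∃ i : ZFSet, i ∈ l ∧ ∃ D, D ∈ Mod i ∧ Y ∈ emb i l (Meas i ∩ D))

/-- `⟨M, F⟩` is iterable: all its iterations (of any ordinal length) are wellfounded,
i.e. realized by transitive models. -/
def Iterable (κ M F : ZFSet.{u}) : Prop :=
  ∀ δ : ZFSet, δ.IsOrdinal → Nonempty (Iteration κ M F δ)

/-! ### Constructibility -/

/-- `X` is a subset of `M` definable over `⟨M, ∈⟩` with parameters. -/
def DefinableSubset (M X : ZFSet.{u}) : Prop :=
  X ⊆ M ∧ ∃ (n : ℕ) (φ : SetLang.Formula (Fin (n + 1))) (v : Fin n → ZFSet.{u})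
    (hv : ∀ i, v i ∈ M.toSet),
    ∀ a : ZFSet, a ∈ X ↔ ∃ ha : a ∈ M.toSet,
      φ.Realize (Fin.cons (⟨a, ha⟩ : M.toSet) (fun i => (⟨v i, hv i⟩ : M.toSet)))

/-- The set of all subsets of `M` definable over `⟨M, ∈⟩` with parameters. -/
noncomputable def DefSet (M : ZFSet.{u}) : ZFSet.{u} :=
  ZFSet.sep (fun X => DefinableSubset M X) (ZFSet.powerset M)

/-- `h` codes the constructible hierarchy up to `δ`: a function with domain `δ` such that
`h(β) = ⋃_{γ<β} Def(h(γ))` for every `β < δ`. -/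
def IsLHierarchy (δ h : ZFSet.{u}) : Prop :=
  δ.IsOrdinal ∧
  (∀ p ∈ h, ∃ β y : ZFSet, β ∈ δ ∧ p = ZFSet.pair β y) ∧
  (∀ β ∈ δ, ∃! y : ZFSet, ZFSet.pair β y ∈ h) ∧
  ∀ β y : ZFSet, ZFSet.pair β y ∈ h →
    ∀ z : ZFSet, z ∈ y ↔ ∃ γ x : ZFSet, γ ∈ β ∧ ZFSet.pair γ x ∈ h ∧ z ∈ DefSet x

/-- `x` is constructible: it appears at some level of some constructible hierarchy. -/
def Constructible (x : ZFSet.{u}) : Prop :=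
  ∃ δ h β y : ZFSet, IsLHierarchy δ h ∧ ZFSet.pair β y ∈ h ∧ x ∈ y

/-- The axiom of constructibility `V = L`. -/
def VeqL : Prop := ∀ x : ZFSet.{u}, Constructible x

/-! ### Normal measures -/

/-- `U` is a normal measure on `κ`: a `κ`-complete nonprincipal ultrafilter on `κ`
closed under diagonal intersections. -/
def IsNormalMeasure (κ U : ZFSet.{u}) : Prop :=
  (∀ X ∈ U, X ⊆ κ) ∧ κ ∈ U ∧ (∅ : ZFSet) ∉ U ∧
  (∀ X Y : ZFSet, X ∈ U → Y ∈ U → X ∩ Y ∈ U) ∧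
  (∀ X Y : ZFSet, X ∈ U → X ⊆ Y → Y ⊆ κ → Y ∈ U) ∧
  (∀ X : ZFSet, X ⊆ κ → (X ∈ U ∨ κ \ X ∈ U)) ∧
  (∀ ξ ∈ κ, ({ξ} : ZFSet) ∉ U) ∧
  (∀ γ f : ZFSet, γ ∈ κ → IsFuncInto γ U.toSet f →
    ZFSet.sep (fun ξ => ∀ a X : ZFSet, ZFSet.pair a X ∈ f → ξ ∈ X) κ ∈ U) ∧
  (∀ f : ZFSet, IsFuncInto κ U.toSet f →
    ZFSet.sep (fun ξ => ∀ a X : ZFSet, ZFSet.pair a X ∈ f → a ∈ ξ → ξ ∈ X) κ ∈ U)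

end LaverDiamond

open LaverDiamond

namespace LaverDiamond

open FirstOrder.Language

/-- Formulas of set theory with named variables. -/
inductive Fml (n : ℕ) : Type
  | mem (i k : Fin n) : Fml n
  | eq (i k : Fin n) : Fml n
  | bot : Fml n
  | imp (φ ψ : Fml n) : Fml n
  | all (i : Fin n) (φ : Fml n) : Fml n

namespace Fml

variable {n : ℕ}

/-- Satisfaction of a formula in a class with the true membership relation. -/
def Sat (M : Set ZFSet.{u}) : Fml n → (Fin n → ZFSet.{u}) → Prop
  | mem i k, v => v i ∈ v k
  | eq i k, v => v i = v k
  | bot, _ => False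
  | imp φ ψ, v => φ.Sat M v → ψ.Sat M v
  | all i φ, v => ∀ x ∈ M, φ.Sat M (Function.update v i x)

/-- The membership symbol. -/
def memSym : SetLang.Relations 2 := memRel.mem

/-- The translation into Mathlib's first-order formulas. -/
def toFormula : Fml n → SetLang.Formula (Fin n)
  | mem i k => Relations.formula₂ memSym (Term.var i) (Term.var k)
  | eq i k => Term.equal (Term.var i) (Term.var k)
  | bot => ⊥
  | imp φ ψ => BoundedFormula.imp φ.toFormula ψ.toFormula
  | all i φ => (BoundedFormula.relabel (n := 1) (k := 0)
      (fun k => if k = i then Sum.inr (0 : Fin 1) else Sum.inl k) φ.toFormula :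
        SetLang.BoundedFormula (Fin n) 1).all

theorem realize_toFormula (M : Set ZFSet.{u}) (φ : Fml n) (v : Fin n → M) :
    φ.toFormula.Realize v ↔ φ.Sat M (fun i => (v i : ZFSet)) := by
  induction φ generalizing v with
  | mem i k =>
    rw [toFormula, Formula.realize_rel₂]
    rfl
  | eq i k =>
    rw [toFormula, Formula.realize_equal]
    exact Subtype.ext_iff
  | bot => rfl
  | imp φ ψ ihφ ihψ => exact imp_congr (ihφ v) (ihψ v)
  | all i φ ih =>
    rw [toFormula, Formula.Realize, BoundedFormula.realize_all, Sat, Subtype.forall]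
    refine forall₂_congr fun x hx => ?_
    refine (BoundedFormula.realize_relabel (m := 1) (n := 0)).trans ?_
    refine (iff_of_eq (congrArg _ (Subsingleton.elim _ default))).trans ?_
    refine (ih _).trans (iff_of_eq (congrArg _ (funext fun k => ?_)))
    by_cases hk : k = i
    · subst hk
      simp [Fin.snoc]
    · simp [hk]

/-- Negation. -/
def neg (φ : Fml n) : Fml n := imp φ bot
/-- Disjunction. -/
def or (φ ψ : Fml n) : Fml n := imp (neg φ) ψ
/-- Conjunction. -/
def and (φ ψ : Fml n) : Fml n := neg (imp φ (neg ψ))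
/-- Equivalence. -/
def iff (φ ψ : Fml n) : Fml n := and (imp φ ψ) (imp ψ φ)
/-- Existential quantification. -/
def ex (i : Fin n) (φ : Fml n) : Fml n := neg (all i (neg φ))

variable {M : Set ZFSet.{u}} {φ ψ : Fml n} {i k : Fin n} {v : Fin n → ZFSet.{u}}

@[simp] theorem sat_mem : (mem i k).Sat M v ↔ v i ∈ v k := Iff.rfl
@[simp] theorem sat_eq : (eq i k).Sat M v ↔ v i = v k := Iff.rfl
@[simp] theorem sat_imp : (imp φ ψ).Sat M v ↔ (φ.Sat M v → ψ.Sat M v) := Iff.rfl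
@[simp] theorem sat_all :
    (all i φ).Sat M v ↔ ∀ x ∈ M, φ.Sat M (Function.update v i x) := Iff.rfl
@[simp] theorem sat_neg : (neg φ).Sat M v ↔ ¬ φ.Sat M v := Iff.rfl
@[simp] theorem sat_or : (or φ ψ).Sat M v ↔ φ.Sat M v ∨ ψ.Sat M v := by
  simp [or, or_iff_not_imp_left]
@[simp] theorem sat_and : (and φ ψ).Sat M v ↔ φ.Sat M v ∧ ψ.Sat M v := by
  simp [and]
@[simp] theorem sat_iff : (iff φ ψ).Sat M v ↔ (φ.Sat M v ↔ ψ.Sat M v) := by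
  simp [iff, iff_def]
@[simp] theorem sat_ex :
    (ex i φ).Sat M v ↔ ∃ x ∈ M, φ.Sat M (Function.update v i x) := by
  simp [ex]

end Fml

/-- The assignment of the four given sets to the first four variables. -/
def assign (a b c d : ZFSet.{u}) : Fin 16 → ZFSet.{u} := fun i =>
  if i = 0 then a else if i = 1 then b else if i = 2 then c else d

theorem ClassEmb.sat_iff {M : Set ZFSet.{u}} (e : ClassEmb V M) (φ : Fml 16)
    (a b c d : ZFSet.{u}) :
    φ.Sat V (assign a b c d) ↔ φ.Sat M (assign (e.j a) (e.j b) (e.j c) (e.j d)) := by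
  have h := e.elem φ.toFormula (assign a b c d) fun _ => Set.mem_univ _
  rw [Fml.realize_toFormula, Fml.realize_toFormula] at h
  refine h.trans (iff_of_eq (congrArg _ (funext fun i => ?_)))
  simp only [assign]
  split_ifs <;> rfl

/-- The unordered pair `{a, b}`, as computed in `M`, belongs to `R`. -/
def UPairIn (M : Set ZFSet.{u}) (a b R : ZFSet.{u}) : Prop :=
  ∃ p ∈ M, p ∈ R ∧ ∀ z ∈ M, z ∈ p ↔ z = a ∨ z = b

/-- `M` satisfies that `ν` is a normal measure on `γ`; relations are coded by sets of
unordered pairs. -/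
def NormalIn (M : Set ZFSet.{u}) (γ ν : ZFSet.{u}) : Prop :=
  (∀ X ∈ M, X ∈ ν → ∀ z ∈ M, z ∈ X → z ∈ γ) ∧
  (∀ X ∈ M, ∀ Y ∈ M, ∀ Z ∈ M, X ∈ ν → Y ∈ ν → (∀ z ∈ M, z ∈ X → z ∈ Y → z ∈ Z) →
    (∀ z ∈ M, z ∈ Z → z ∈ γ) → Z ∈ ν) ∧
  (∀ X ∈ M, ∀ Y ∈ M, (∀ z ∈ M, z ∈ X → z ∈ γ) → (∀ z ∈ M, z ∈ Y → z ∈ γ) →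
    (∀ z ∈ M, z ∈ γ → z ∈ X ∨ z ∈ Y) → X ∈ ν ∨ Y ∈ ν) ∧
  (∀ X ∈ M, X ∈ ν → ∃ z ∈ M, z ∈ X) ∧
  (∀ a ∈ M, a ∈ γ → ∀ X ∈ M, (∀ z ∈ M, z ∈ X → z ∈ γ) →
    (∀ b ∈ M, b ∈ γ → a ∈ b → b ∈ X) → X ∈ ν) ∧
  (∀ R ∈ M, (∀ a ∈ M, a ∈ γ → ∃ X ∈ M, X ∈ ν ∧ ∀ b ∈ M, b ∈ X → a ∈ b → UPairIn M a b R) →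
    ∀ Y ∈ M, (∀ z ∈ M, z ∈ Y → z ∈ γ) →
      (∀ b ∈ M, b ∈ γ → (∀ a ∈ M, a ∈ b → UPairIn M a b R) → b ∈ Y) → Y ∈ ν)

/-- Either every subset of `γ` is guessed by `L` modulo a normal measure on `γ` lying in `M`,
or the section of `L` at `γ` is not guessed modulo any such measure. -/
def GuessIn (M : Set ZFSet.{u}) (L γ : ZFSet.{u}) : Prop :=
  (∀ E ∈ M, (∀ z ∈ M, z ∈ E → z ∈ γ) → ∃ ν ∈ M, NormalIn M γ ν ∧ ∃ X ∈ M, X ∈ ν ∧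
    ∀ b ∈ M, b ∈ X → ∀ d ∈ M, d ∈ b → (d ∈ E ↔ UPairIn M d b L)) ∨
  ∀ ν ∈ M, NormalIn M γ ν → ¬ ∃ X ∈ M, X ∈ ν ∧
    ∀ b ∈ M, b ∈ X → ∀ d ∈ M, d ∈ b → (UPairIn M d γ L ↔ UPairIn M d b L)

namespace Fml

/-- The formula expressing `UPairIn`; it uses the variables `14` and `15`. -/
def upair (a b R : Fin 16) : Fml 16 :=
  ex 14 (and (mem 14 R) (all 15 (iff (mem 15 14) (or (eq 15 a) (eq 15 b)))))

/-- The formula expressing inclusion; it uses the variable `15`. -/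
def sub (X Y : Fin 16) : Fml 16 := all 15 (imp (mem 15 X) (mem 15 Y))

/-- The formula expressing `NormalIn` for the variables `2` and `3`. -/
def normal : Fml 16 :=
  and (all 5 (imp (mem 5 3) (sub 5 2))) <|
  and (all 5 (all 6 (all 7 (imp (mem 5 3) (imp (mem 6 3)
    (imp (all 15 (imp (mem 15 5) (imp (mem 15 6) (mem 15 7)))) (imp (sub 7 2) (mem 7 3)))))))) <|
  and (all 5 (all 6 (imp (sub 5 2) (imp (sub 6 2)
    (imp (all 15 (imp (mem 15 2) (or (mem 15 5) (mem 15 6)))) (or (mem 5 3) (mem 6 3))))))) <|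
  and (all 5 (imp (mem 5 3) (ex 15 (mem 15 5)))) <|
  and (all 8 (imp (mem 8 2) (all 5 (imp (sub 5 2)
    (imp (all 9 (imp (mem 9 2) (imp (mem 8 9) (mem 9 5)))) (mem 5 3)))))) <|
  all 7 (imp (all 8 (imp (mem 8 2) (ex 5 (and (mem 5 3)
    (all 9 (imp (mem 9 5) (imp (mem 8 9) (upair 8 9 7))))))))
    (all 6 (imp (sub 6 2)
      (imp (all 9 (imp (mem 9 2) (imp (all 8 (imp (mem 8 9) (upair 8 9 7))) (mem 9 6))))
        (mem 6 3)))))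

/-- The formula expressing `GuessIn` for all members `2` of `0`, with `1` in place of `L`. -/
def guess : Fml 16 :=
  all 2 (imp (mem 2 0) (or
    (all 4 (imp (sub 4 2) (ex 3 (and normal (ex 5 (and (mem 5 3)
      (all 9 (imp (mem 9 5) (all 8 (imp (mem 8 9) (iff (mem 8 4) (upair 8 9 1))))))))))))
    (all 3 (imp normal (neg (ex 5 (and (mem 5 3)
      (all 9 (imp (mem 9 5) (all 8 (imp (mem 8 9)
        (iff (upair 8 2 1) (upair 8 9 1)))))))))))))

theorem sat_normal (M : Set ZFSet.{u}) (v : Fin 16 → ZFSet.{u}) :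
    normal.Sat M v ↔ NormalIn M (v 2) (v 3) := by
  simp [normal, NormalIn, sub, upair, UPairIn]

theorem sat_guess (M : Set ZFSet.{u}) (κ L a b : ZFSet.{u}) :
    guess.Sat M (assign κ L a b) ↔ ∀ γ ∈ M, γ ∈ κ → GuessIn M L γ := by
  simp [guess, GuessIn, sat_normal, sub, upair, UPairIn, assign]

end Fml
end LaverDiamond

namespace LaverDiamond

theorem mem_V (x : ZFSet.{u}) : x ∈ V := Set.mem_univ x

/-- The set of unordered pairs coding the restriction of the relation `R` to pairs
`a ∈ b ∈ κ`. -/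
noncomputable def pairSet (κ : ZFSet.{u}) (R : ZFSet.{u} → ZFSet.{u} → Prop) : ZFSet.{u} :=
  ZFSet.sep (fun p => ∃ b ∈ κ, ∃ a ∈ b, p = {a, b} ∧ R a b) (ZFSet.powerset κ)

theorem mem_pairSet {κ a b : ZFSet.{u}} (hκ : κ.IsOrdinal) (hb : b ∈ κ) (ha : a ∈ b)
    (R : ZFSet.{u} → ZFSet.{u} → Prop) : ({a, b} : ZFSet) ∈ pairSet κ R ↔ R a b := by
  rw [pairSet, ZFSet.mem_sep, ZFSet.mem_powerset]
  constructor
  · rintro ⟨-, b', -, a', ha', h, hR⟩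
    have h1 : a ∈ ({a', b'} : ZFSet) := h ▸ ZFSet.mem_pair.2 (Or.inl rfl)
    have h2 : b ∈ ({a', b'} : ZFSet) := h ▸ ZFSet.mem_pair.2 (Or.inr rfl)
    rw [ZFSet.mem_pair] at h1 h2
    rcases h1 with rfl | rfl <;> rcases h2 with rfl | rfl
    · exact (ZFSet.mem_irrefl _ ha).elim
    · exact hR
    · exact (ZFSet.mem_asymm ha ha').elim
    · exact (ZFSet.mem_irrefl _ ha).elim
  · refine fun hR => ⟨fun z hz => ?_, b, hb, a, ha, rfl, hR⟩
    rcases ZFSet.mem_pair.1 hz with rfl | rfl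
    · exact hκ.mem_trans ha hb
    · exact hb

theorem upairIn_iff {M : Set ZFSet.{u}} (hM : TransClass M) {a b R : ZFSet.{u}} (ha : a ∈ M)
    (hb : b ∈ M) (hR : R ∈ M) : UPairIn M a b R ↔ ({a, b} : ZFSet) ∈ R := by
  constructor
  · rintro ⟨p, hp, hpR, h⟩
    have : p = {a, b} := by
      ext z
      rw [ZFSet.mem_pair]
      refine ⟨fun hz => (h z (hM p hp z hz)).1 hz, fun hz => (h z ?_).2 hz⟩
      rcases hz with rfl | rfl <;> assumption
    exact this ▸ hpR
  · exact fun h => ⟨_, hM R hR _ h, h, fun z _ => ZFSet.mem_pair⟩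

theorem upairIn_V {a b R : ZFSet.{u}} : UPairIn V a b R ↔ ({a, b} : ZFSet) ∈ R :=
  upairIn_iff (fun _ _ y _ => mem_V y) (mem_V a) (mem_V b) (mem_V R)

/-- A normal measure on `κ`, with normality stated for arbitrary relations. -/
structure NormalMeas (κ ν : ZFSet.{u}) : Prop where
  inter : ∀ {X Y Z : ZFSet.{u}}, X ∈ ν → Y ∈ ν → (∀ z ∈ X, z ∈ Y → z ∈ Z) → Z ⊆ κ → Z ∈ ν
  ultra : ∀ {X Y : ZFSet.{u}}, X ⊆ κ → Y ⊆ κ → (∀ z ∈ κ, z ∈ X ∨ z ∈ Y) → X ∈ ν ∨ Y ∈ ν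
  nonempty : ∀ {X : ZFSet.{u}}, X ∈ ν → ∃ z, z ∈ X
  subset : ∀ {X : ZFSet.{u}}, X ∈ ν → X ⊆ κ
  tail : ∀ {a : ZFSet.{u}}, a ∈ κ → ZFSet.sep (fun b => a ∈ b) κ ∈ ν
  diag : ∀ R : ZFSet.{u} → ZFSet.{u} → Prop, (∀ a ∈ κ, ZFSet.sep (R a) κ ∈ ν) →
    ZFSet.sep (fun b => ∀ a ∈ b, R a b) κ ∈ ν

theorem NormalIn.normalMeas {M : Set ZFSet.{u}} {κ ν : ZFSet.{u}} (h : NormalIn M κ ν)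
    (hM : TransClass M) (hν : ν ∈ M) (hsub : ∀ X, X ⊆ κ → X ∈ M)
    (hpair : ∀ R : ZFSet.{u} → ZFSet.{u} → Prop,
      ∃ R' ∈ M, ∀ b ∈ κ, ∀ a ∈ b, (({a, b} : ZFSet) ∈ R' ↔ R a b)) : NormalMeas κ ν := by
  obtain ⟨h1, h2, h3, h4, h5, h6⟩ := h
  have hνM : ∀ {X}, X ∈ ν → X ∈ M := fun hX => hM ν hν _ hX
  have hκM : ∀ {a}, a ∈ κ → a ∈ M := fun {a} ha => hM κ (hsub κ fun _ h => h) a ha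
  refine ⟨?_, ?_, ?_, ?_, ?_, ?_⟩
  · exact fun {X Y Z} hX hY hXY hZ => h2 X (hνM hX) Y (hνM hY) Z (hsub Z hZ) hX hY
      (fun z _ => hXY z) fun z _ hz => hZ hz
  · exact fun {X Y} hX hY hXY => h3 X (hsub X hX) Y (hsub Y hY) (fun z _ hz => hX hz)
      (fun z _ hz => hY hz) fun z _ => hXY z
  · exact fun {X} hX => (h4 X (hνM hX) hX).imp fun z hz => hz.2
  · exact fun {X} hX z hz => h1 X (hνM hX) hX z (hM X (hνM hX) z hz) hz
  · exact fun {a} ha => h5 a (hκM ha) ha _ (hsub _ ZFSet.sep_subset)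
      (fun z _ hz => (ZFSet.mem_sep.1 hz).1) fun b _ hb hab => ZFSet.mem_sep.2 ⟨hb, hab⟩
  · intro R hR
    obtain ⟨R', hR'M, hR'⟩ := hpair R
    refine h6 R' hR'M (fun a haM ha => ?_) _ (hsub _ ZFSet.sep_subset)
      (fun z _ hz => (ZFSet.mem_sep.1 hz).1) fun b hbM hb hba => ZFSet.mem_sep.2 ⟨hb, fun a ha => ?_⟩
    · refine ⟨_, hνM (hR a ha), hR a ha, fun b hbM hb hab => ?_⟩
      rw [ZFSet.mem_sep] at hb
      exact (upairIn_iff hM haM hbM hR'M).2 ((hR' b hb.1 a hab).2 hb.2)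
    · have haM := hM b hbM a ha
      exact (hR' b hb a ha).1 ((upairIn_iff hM haM hbM hR'M).1 (hba a haM ha))

namespace MeasEmb

variable {κ : ZFSet.{u}} (E : MeasEmb κ)

theorem j_mem (x : ZFSet.{u}) : E.e.j x ∈ E.M := E.e.maps x (mem_V x)

theorem mem_j {x y : ZFSet.{u}} (h : y ∈ E.e.j x) : y ∈ E.M := E.trans _ (E.j_mem x) y h

theorem mem_of_mem_kappa {x : ZFSet.{u}} (h : x ∈ κ) : x ∈ E.M :=
  E.trans _ (E.mem_j E.crit.2.1) x h

theorem j_eq {a : ZFSet.{u}} (ha : a ∈ κ) : E.e.j a = a := E.crit.2.2 a (E.crit.1.mem ha) ha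

theorem mem_iff (a b : ZFSet.{u}) : a ∈ b ↔ E.e.j a ∈ E.e.j b := by
  simpa [assign] using E.e.sat_iff (.mem 0 1) a b b b

theorem j_upair (a b : ZFSet.{u}) : E.e.j {a, b} = {E.e.j a, E.e.j b} := by
  have h := E.e.sat_iff (.all 15 (.iff (.mem 15 2) (.or (.eq 15 0) (.eq 15 1)))) a b {a, b} a
  simp [assign] at h
  ext z
  rw [ZFSet.mem_pair]
  refine ⟨fun hz => (h z (E.mem_j hz)).1 hz, fun hz => (h z ?_).2 hz⟩
  rcases hz with rfl | rfl <;> exact E.j_mem _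

theorem mem_j_iff {a X : ZFSet.{u}} (ha : a ∈ κ) : a ∈ E.e.j X ↔ a ∈ X := by
  rw [E.mem_iff a X, E.j_eq ha]

theorem upair_mem_j_iff {a b R : ZFSet.{u}} (hb : b ∈ κ) (ha : a ∈ b) :
    ({a, b} : ZFSet) ∈ E.e.j R ↔ ({a, b} : ZFSet) ∈ R := by
  rw [E.mem_iff {a, b} R, E.j_upair, E.j_eq hb, E.j_eq (E.crit.1.mem_trans ha hb)]

theorem subset_mem {X : ZFSet.{u}} (hX : X ⊆ κ) : X ∈ E.M := by
  have h := E.e.sat_iff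
    (.all 0 (.all 1 (.ex 2 (.all 15 (.iff (.mem 15 2) (.and (.mem 15 0) (.mem 15 1))))))) κ κ κ κ
  simp at h
  obtain ⟨Y, hY, h⟩ := h.1 (fun x _ y _ => ⟨x ∩ y, mem_V _, fun z _ => ZFSet.mem_inter⟩)
    (E.e.j X) (E.j_mem X) κ (E.mem_j E.crit.2.1)
  have : X = Y := by
    ext z
    refine ⟨fun hz => (h z (E.mem_of_mem_kappa (hX hz))).2
      ⟨(E.mem_j_iff (hX hz)).2 hz, hX hz⟩, fun hz => ?_⟩
    have hz := (h z (E.trans Y hY z hz)).1 hz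
    exact (E.mem_j_iff hz.2).1 hz.1
  exact this ▸ hY

theorem normalMeas {ν : ZFSet.{u}} (hν : ν ∈ E.M) (h : NormalIn E.M κ ν) : NormalMeas κ ν :=
  h.normalMeas E.trans hν (fun _ => E.subset_mem) fun R =>
    ⟨_, E.j_mem (pairSet κ R), fun _ hb _ ha =>
      (E.upair_mem_j_iff hb ha).trans (mem_pairSet E.crit.1 hb ha R)⟩

theorem normalIn {μ : ZFSet.{u}} (hμ : ∀ X : ZFSet, X ∈ μ ↔ X ⊆ κ ∧ κ ∈ E.e.j X) :
    NormalIn E.M κ μ := by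
  have hκκ := E.crit.2.1
  have hκM := E.mem_j hκκ
  have hsub : ∀ {X}, X ∈ E.M → (∀ z ∈ E.M, z ∈ X → z ∈ κ) → X ⊆ κ :=
    fun {X} hX h z hz => h z (E.trans X hX z hz) hz
  refine ⟨?_, ?_, ?_, ?_, ?_, ?_⟩
  · exact fun X _ hX z _ hz => ((hμ X).1 hX).1 hz
  · intro X hXM Y _ Z hZM hX hY h hZ
    have ht := E.e.sat_iff
      (.all 15 (.imp (.mem 15 0) (.imp (.mem 15 1) (.mem 15 2)))) X Y Z Z
    simp [assign] at ht
    exact (hμ Z).2 ⟨hsub hZM hZ, ht.1 (fun z _ hz => h z (E.trans X hXM z hz) hz) κ hκM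
      ((hμ X).1 hX).2 ((hμ Y).1 hY).2⟩
  · intro X hXM Y hYM hX hY h
    have ht := E.e.sat_iff
      (.all 15 (.imp (.mem 15 2) (.or (.mem 15 0) (.mem 15 1)))) X Y κ κ
    simp [assign] at ht
    rw [hμ, hμ]
    exact (ht.1 (fun z _ hz => h z (E.mem_of_mem_kappa hz) hz) κ hκM hκκ).imp
      (fun h => ⟨hsub hXM hX, h⟩) fun h => ⟨hsub hYM hY, h⟩
  · intro X hXM hX
    have ht := E.e.sat_iff (.ex 15 (.mem 15 0)) X X X X
    simp [assign] at ht
    obtain ⟨z, -, hz⟩ := ht.2 ⟨κ, hκM, ((hμ X).1 hX).2⟩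
    exact ⟨z, E.trans X hXM z hz, hz⟩
  · intro a _ ha X hXM hX h
    have ht := E.e.sat_iff
      (.all 15 (.imp (.mem 15 1) (.imp (.mem 0 15) (.mem 15 2)))) a κ X X
    simp [assign, E.j_eq ha] at ht
    exact (hμ X).2 ⟨hsub hXM hX, ht.1 (fun b _ hb => h b (E.mem_of_mem_kappa hb) hb) κ hκM hκκ ha⟩
  · intro R hRM hR Y hYM hYκ hY
    refine (hμ Y).2 ⟨hsub hYM hYκ, ?_⟩
    have ht := E.e.sat_iff (.all 9 (.imp (.mem 9 0)
      (.imp (.all 8 (.imp (.mem 8 9) (.upair 8 9 1))) (.mem 9 2)))) κ R Y Y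
    simp [assign, Fml.upair] at ht
    refine ht.1 (fun b _ hb h => hY b (E.mem_of_mem_kappa hb) hb fun a haM ha => ?_) κ hκM hκκ
      fun a haM ha => ?_
    · exact (upairIn_iff E.trans haM (E.mem_of_mem_kappa hb) hRM).2
        (upairIn_V.1 (h a (mem_V a) ha))
    · obtain ⟨X, hXM, hX, h⟩ := hR a haM ha
      have ht' := E.e.sat_iff (.all 9 (.imp (.mem 9 0) (.imp (.mem 2 9) (.upair 2 9 1)))) X R a a
      simp [assign, Fml.upair, E.j_eq ha] at ht'
      refine ht'.1 (fun b _ hb hab => upairIn_V.2 ?_) κ hκM ((hμ X).1 hX).2 ha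
      have hbM := E.trans X hXM b hb
      exact (upairIn_iff E.trans haM hbM hRM).1 (h b hbM hb hab)

end MeasEmb
end LaverDiamond

namespace LaverDiamond

/-- The sequence `S` guesses `E ⊆ γ` modulo a normal measure on `γ`. -/
def Guesses (S : ZFSet.{u} → ZFSet.{u}) (γ E : ZFSet.{u}) : Prop :=
  ∃ ν, NormalIn V γ ν ∧ ∃ X ∈ ν, ∀ b ∈ X, ∀ d ∈ b, d ∈ E ↔ d ∈ S b

theorem exists_antiguessing_sequence : ∃ S : ZFSet.{u} → ZFSet.{u},
    ∀ γ, (∃ E, E ⊆ γ ∧ ¬ Guesses S γ E) → ¬ Guesses S γ (S γ) := by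
  classical
  let P (γ : ZFSet.{u}) (ih : ∀ b, b ∈ γ → ZFSet.{u}) (E : ZFSet.{u}) : Prop :=
    E ⊆ γ ∧ ¬ ∃ ν, NormalIn V γ ν ∧ ∃ X ∈ ν, ∀ b ∈ X, ∀ hb : b ∈ γ, ∀ d ∈ b, d ∈ E ↔ d ∈ ih b hb
  let S : ZFSet.{u} → ZFSet.{u} := ZFSet.mem_wf.fix fun γ ih =>
    if h : ∃ E, P γ ih E then h.choose else ∅
  have hP : ∀ γ E, P γ (fun b _ => S b) E ↔ E ⊆ γ ∧ ¬ Guesses S γ E := by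
    refine fun γ E => and_congr_right fun _ => not_congr <| exists_congr fun ν =>
      and_congr_right fun hν => exists_congr fun X => and_congr_right fun hX =>
      forall₂_congr fun b hb => ⟨fun h => h (hν.1 X (mem_V X) hX b (mem_V b) hb), fun h _ => h⟩
  refine ⟨S, fun γ h => ?_⟩
  have h' : ∃ E, P γ (fun b _ => S b) E := by simpa only [hP] using h
  have hS : S γ = h'.choose := by
    rw [show S γ = _ from ZFSet.mem_wf.fix_eq _ γ]
    exact dif_pos h'
  rw [hS]
  exact ((hP _ _).1 h'.choose_spec).2

/-- A diamond sequence for subsets of `κ` whose guesses are correct modulo a normal measure. -/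
theorem exists_guessing_sequence {κ : ZFSet.{u}} (E : MeasEmb κ) {μ : ZFSet.{u}} (hμM : μ ∈ E.M)
    (hμ : ∀ X : ZFSet, X ∈ μ ↔ X ⊆ κ ∧ κ ∈ E.e.j X) :
    ∃ S : ZFSet.{u} → ZFSet.{u}, ∀ A, A ⊆ κ → ∃ ν, NormalMeas κ ν ∧
      ZFSet.sep (fun b => ∀ d ∈ b, d ∈ A ↔ d ∈ S b) κ ∈ ν := by
  obtain ⟨S, hS⟩ := exists_antiguessing_sequence.{u}
  have hκ := E.crit.1
  have hκκ := E.crit.2.1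
  have hκM := E.mem_j hκκ
  set L := pairSet κ fun d b => d ∈ S b with hL
  have hmem : ∀ b ∈ κ, ∀ d ∈ b, (({d, b} : ZFSet) ∈ L ↔ d ∈ S b) :=
    fun b hb d hd => mem_pairSet hκ hb hd _
  have hV : ∀ γ ∈ V, γ ∈ κ → GuessIn V L γ := by
    intro γ _ hγ
    by_cases h : ∃ A, A ⊆ γ ∧ ¬ Guesses S γ A
    · refine Or.inr fun ν _ hν => ?_
      rintro ⟨X, -, hX, h'⟩
      refine hS γ h ⟨ν, hν, X, hX, fun b hb d hd => ?_⟩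
      have hbγ := hν.1 X (mem_V X) hX b (mem_V b) hb
      rw [← hmem γ hγ d ((hκ.mem hγ).mem_trans hd hbγ), ← hmem b (hκ.mem_trans hbγ hγ) d hd,
        ← upairIn_V, ← upairIn_V]
      exact h' b (mem_V b) hb d (mem_V d) hd
    · refine Or.inl fun A _ hA => ?_
      obtain ⟨ν, hν, X, hX, h'⟩ := not_not.1 fun h' => h ⟨A, fun z => hA z (mem_V z), h'⟩
      refine ⟨ν, mem_V ν, hν, X, mem_V X, hX, fun b _ hb d _ hd => ?_⟩
      rw [upairIn_V, hmem b (hκ.mem_trans (hν.1 X (mem_V X) hX b (mem_V b) hb) hγ) d hd]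
      exact h' b hb d hd
  have hM := (Fml.sat_guess _ _ _ _ _).1
    ((E.e.sat_iff Fml.guess κ L κ κ).1 ((Fml.sat_guess _ _ _ _ _).2 hV)) κ hκM hκκ
  have hLM := E.j_mem L
  rcases hM with hM | hM
  · refine ⟨S, fun A hA => ?_⟩
    obtain ⟨ν, hνM, hν, X, hXM, hX, h⟩ := hM A (E.subset_mem hA) fun z _ hz => hA hz
    have hν' := E.normalMeas hνM hν
    refine ⟨ν, hν', hν'.inter hX hX (fun b hb _ => ?_) ZFSet.sep_subset⟩
    have hbκ := hν'.subset hX hb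
    have hbM := E.mem_of_mem_kappa hbκ
    refine ZFSet.mem_sep.2 ⟨hbκ, fun d hd => ?_⟩
    have hdM := E.trans b hbM d hd
    rw [h b hbM hb d hdM hd, upairIn_iff E.trans hdM hbM hLM, E.upair_mem_j_iff hbκ hd,
      hmem b hbκ d hd]
  · set A := ZFSet.sep (fun d => ({d, κ} : ZFSet) ∈ E.e.j L) κ with hA
    set X := ZFSet.sep (fun b => ∀ d ∈ b, d ∈ A ↔ ({d, b} : ZFSet) ∈ L) κ with hX
    have hXM : X ∈ E.M := E.subset_mem ZFSet.sep_subset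
    have ht := E.e.sat_iff (.all 9 (.imp (.mem 9 0)
      (.imp (.all 8 (.imp (.mem 8 9) (.iff (.mem 8 2) (.upair 8 9 3)))) (.mem 9 1)))) κ X A L
    simp [assign, Fml.upair] at ht
    refine (hM μ hμM (E.normalIn hμ) ⟨X, hXM, (hμ X).2 ⟨ZFSet.sep_subset, ?_⟩, ?_⟩).elim
    · refine ht.1 (fun b _ hb h => ZFSet.mem_sep.2 ⟨hb, fun d hd => ?_⟩) κ hκM hκκ
        fun d hdM hd => ?_
      · rw [← upairIn_V]
        exact h d (mem_V d) hd
      · refine Iff.trans ?_ (upairIn_iff E.trans hdM hκM hLM).symm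
        rw [E.mem_j_iff hd, hA, ZFSet.mem_sep]
        exact and_iff_right hd
    · intro b hbM hb d hdM hd
      rw [hX, ZFSet.mem_sep] at hb
      rw [upairIn_iff E.trans hdM hκM hLM, upairIn_iff E.trans hdM hbM hLM,
        E.upair_mem_j_iff hb.1 hd, ← hb.2 d hd, hA, ZFSet.mem_sep]
      exact (and_iff_right (hκ.mem_trans hd hb.1)).symm

end LaverDiamond

namespace LaverDiamond

/-! ### The Mostowski collapse -/

section Collapse

variable {T : Type*} (r : T → T → Prop)

open Classical in
/-- The Mostowski collapse of a well-founded set-like relation. -/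
noncomputable def collapse (x : T) : ZFSet.{u} :=
  if h : WellFounded r ∧ ∀ x, Small.{u} {y // r y x} then
    h.1.fix (C := fun _ => ZFSet.{u}) (fun x ih =>
      haveI := h.2 x
      ZFSet.range fun y : {y // r y x} => ih y.1 y.2) x
  else ∅

variable {r}

theorem mem_collapse (hr : WellFounded r) (hs : ∀ x, Small.{u} {y // r y x}) {x : T}
    {z : ZFSet.{u}} : z ∈ collapse r x ↔ ∃ y, r y x ∧ collapse r y = z := by
  have h : WellFounded r ∧ ∀ x, Small.{u} {y // r y x} := ⟨hr, hs⟩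
  rw [collapse, dif_pos h, WellFounded.fix_eq]
  have := hs x
  simp only [ZFSet.mem_range, Subtype.exists]
  refine exists_congr fun y => ?_
  rw [collapse, dif_pos h, exists_prop]

theorem collapse_mem (hr : WellFounded r) (hs : ∀ x, Small.{u} {y // r y x}) {x y : T}
    (h : r y x) : (collapse r y : ZFSet.{u}) ∈ collapse r x :=
  (mem_collapse hr hs).2 ⟨y, h, rfl⟩

theorem collapse_injective (hr : WellFounded r) (hs : ∀ x, Small.{u} {y // r y x})
    (hext : ∀ x y, (∀ z, r z x ↔ r z y) → x = y) :
    Function.Injective (collapse r : T → ZFSet.{u}) := by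
  intro x
  induction x using hr.induction with
  | _ x ih =>
    intro y hxy
    refine hext x y fun z => ⟨fun hz => ?_, fun hz => ?_⟩
    · obtain ⟨w, hw, hwz⟩ := (mem_collapse hr hs).1 (hxy ▸ collapse_mem hr hs hz)
      rwa [ih z hz hwz.symm]
    · obtain ⟨w, hw, hwz⟩ := (mem_collapse hr hs).1 (hxy ▸ collapse_mem hr hs hz)
      rwa [← ih w hw hwz]

theorem collapse_mem_iff (hr : WellFounded r) (hs : ∀ x, Small.{u} {y // r y x})
    (hext : ∀ x y, (∀ z, r z x ↔ r z y) → x = y) {x y : T} :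
    (collapse r y : ZFSet.{u}) ∈ collapse r x ↔ r y x := by
  refine ⟨fun h => ?_, collapse_mem hr hs⟩
  obtain ⟨w, hw, hwy⟩ := (mem_collapse hr hs).1 h
  rwa [← collapse_injective hr hs hext hwy]

end Collapse

namespace NormalMeas

open Filter

variable {κ ν : ZFSet.{u}}

theorem self_mem (hν : NormalMeas κ ν) : κ ∈ ν := by
  have h : κ ⊆ κ := fun _ h => h
  simpa using hν.ultra h h fun z hz => Or.inl hz

/-- The ultrafilter on the class of all sets generated by a normal measure. -/
def uf (hν : NormalMeas κ ν) : Ultrafilter ZFSet.{u} :=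
  Ultrafilter.ofComplNotMemIff
    { sets := {s | ZFSet.sep (· ∈ s) κ ∈ ν}
      univ_sets := by
        refine hν.inter hν.self_mem hν.self_mem (fun z hz _ => ?_) ZFSet.sep_subset
        exact ZFSet.mem_sep.2 ⟨hz, trivial⟩
      sets_of_superset := fun {x y} hx hxy => hν.inter hx hx
        (fun z hz _ => by rw [ZFSet.mem_sep] at hz ⊢; exact ⟨hz.1, hxy hz.2⟩) ZFSet.sep_subset
      inter_sets := fun {x y} hx hy => hν.inter hx hy
        (fun z hz hz' => by rw [ZFSet.mem_sep] at hz hz' ⊢; exact ⟨hz.1, hz.2, hz'.2⟩)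
        ZFSet.sep_subset }
    fun s => by
      change ZFSet.sep (· ∈ sᶜ) κ ∉ ν ↔ ZFSet.sep (· ∈ s) κ ∈ ν
      constructor
      · intro h
        refine (hν.ultra ZFSet.sep_subset ZFSet.sep_subset fun z hz => ?_).resolve_right h
        rw [ZFSet.mem_sep, ZFSet.mem_sep]
        exact (em (z ∈ s)).imp (⟨hz, ·⟩) (⟨hz, ·⟩)
      · intro h h'
        obtain ⟨z, hz⟩ := hν.nonempty (hν.inter (Z := ∅) h h' (fun z hz hz' =>
          ((ZFSet.mem_sep.1 hz').2 (ZFSet.mem_sep.1 hz).2).elim) (ZFSet.empty_subset κ))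
        exact ZFSet.notMem_empty z hz

theorem eventually_iff (hν : NormalMeas κ ν) {P : ZFSet.{u} → Prop} :
    (∀ᶠ b in hν.uf, P b) ↔ ZFSet.sep P κ ∈ ν := Iff.rfl

theorem eventually_mem (hν : NormalMeas κ ν) : ∀ᶠ b in hν.uf, b ∈ κ :=
  hν.eventually_iff.2 <| hν.inter hν.self_mem hν.self_mem
    (fun _ hz _ => ZFSet.mem_sep.2 ⟨hz, hz⟩) ZFSet.sep_subset

theorem eventually_tail (hν : NormalMeas κ ν) {a : ZFSet.{u}} (ha : a ∈ κ) :
    ∀ᶠ b in (hν.uf : Filter ZFSet.{u}), a ∈ b := hν.eventually_iff.2 (hν.tail ha)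

theorem eventually_diag (hν : NormalMeas κ ν) {R : ZFSet.{u} → ZFSet.{u} → Prop}
    (h : ∀ a ∈ κ, ∀ᶠ b in hν.uf, R a b) : ∀ᶠ b in hν.uf, ∀ a ∈ b, R a b :=
  hν.eventually_iff.2 (hν.diag R fun a ha => hν.eventually_iff.1 (h a ha))

theorem exists_eventually_eq (hν : NormalMeas κ ν) {f : ZFSet.{u} → ZFSet.{u}}
    (hf : ∀ᶠ b in hν.uf, f b ∈ b) : ∃ a ∈ κ, ∀ᶠ b in hν.uf, f b = a := by
  by_contra! h
  have h' := hν.eventually_diag (R := fun a b => f b ≠ a)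
    h
  obtain ⟨b, hb, hb'⟩ := (hf.and h').exists
  exact hb' _ hb rfl

theorem eventually_forall_mem (hκ : κ.IsOrdinal) (hν : NormalMeas κ ν) {c : ZFSet.{u}}
    (hc : c ∈ κ) {P : ZFSet.{u} → ZFSet.{u} → Prop} (h : ∀ a ∈ c, ∀ᶠ b in hν.uf, P a b) :
    ∀ᶠ b in hν.uf, ∀ a ∈ c, P a b := by
  have h' := hν.eventually_diag (R := fun a b => a ∈ c → P a b) fun a _ => by
    by_cases hac : a ∈ c
    · exact (h a hac).mono fun b hb _ => hb
    · exact Eventually.of_forall fun b hb => (hac hb).elim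
  filter_upwards [h', hν.eventually_tail hc, hν.eventually_mem] with b hb hcb hbκ a ha
  exact hb a ((hκ.mem hbκ).mem_trans ha hcb) ha

theorem succ_mem (hκ : κ.IsOrdinal) (hν : NormalMeas κ ν) {a : ZFSet.{u}} (ha : a ∈ κ) :
    insert a a ∈ κ := by
  obtain ⟨b, hab, hb⟩ := ((hν.eventually_tail ha).and hν.eventually_mem).exists
  have hb' := hκ.mem hb
  rcases (ZFSet.isOrdinal_succ (hκ.mem ha)).mem_trichotomous hκ with h | h | h
  · exact h
  · rw [← h, ZFSet.mem_insert_iff] at hb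
    rcases hb with rfl | hb
    · exact (ZFSet.mem_irrefl _ hab).elim
    · exact (ZFSet.mem_asymm hab hb).elim
  · rw [ZFSet.mem_insert_iff] at h
    rcases h with rfl | h
    · exact (ZFSet.mem_irrefl _ ha).elim
    · exact (ZFSet.mem_asymm ha h).elim

theorem exists_limit (hκ : κ.IsOrdinal) (hν : NormalMeas κ ν) :
    ∃ c ∈ κ, ∅ ∈ c ∧ ∀ a ∈ c, insert a a ∈ c := by
  obtain ⟨z, hz⟩ := hν.nonempty hν.self_mem
  have h0 : ∅ ∈ κ := by
    rcases ZFSet.isOrdinal_empty.mem_trichotomous hκ with h | rfl | h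
    · exact h
    · exact (ZFSet.notMem_empty _ hz).elim
    · exact (ZFSet.notMem_empty _ h).elim
  have hlim : ∀ᶠ b in (hν.uf : Filter ZFSet.{u}), ¬ ∃ p, b = insert p p := by
    rw [Ultrafilter.eventually_not]
    intro h
    have : ∀ b : ZFSet.{u}, ∃ p : ZFSet.{u}, (∃ p, b = insert p p) → b = insert p p := fun b => by
      by_cases hb : ∃ p, b = insert p p
      · exact ⟨hb.choose, fun _ => hb.choose_spec⟩
      · exact ⟨∅, fun h => (hb h).elim⟩
    choose f hf using this
    obtain ⟨a, ha, hfa⟩ := hν.exists_eventually_eq (f := f)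
      (h.mono fun b hb => by
        have := ZFSet.mem_insert (f b) (f b)
        rwa [← hf b hb] at this)
    obtain ⟨b, ⟨hb, hfb⟩, hb'⟩ :=
      ((h.and hfa).and (hν.eventually_tail (hν.succ_mem hκ ha))).exists
    rw [hf b hb, hfb] at hb'
    exact ZFSet.mem_irrefl _ hb'
  obtain ⟨c, ⟨hc, h0c⟩, hcκ⟩ :=
    ((hlim.and (hν.eventually_tail h0)).and hν.eventually_mem).exists
  refine ⟨c, hcκ, h0c, fun a ha => ?_⟩
  have hco := hκ.mem hcκ
  rcases (ZFSet.isOrdinal_succ (hco.mem ha)).mem_trichotomous hco with h | h | h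
  · exact h
  · exact (hc ⟨a, h.symm⟩).elim
  · rw [ZFSet.mem_insert_iff] at h
    rcases h with rfl | h
    · exact (ZFSet.mem_irrefl _ ha).elim
    · exact (ZFSet.mem_asymm ha h).elim

theorem eventually_forall_nat (hκ : κ.IsOrdinal) (hν : NormalMeas κ ν)
    {P : ℕ → ZFSet.{u} → Prop} (h : ∀ n, ∀ᶠ b in hν.uf, P n b) :
    ∀ᶠ b in hν.uf, ∀ n, P n b := by
  obtain ⟨c, hc, h0, hs⟩ := hν.exists_limit hκ
  have hnat : ∀ n : ℕ, (n : Ordinal.{u}).toZFSet ∈ c := fun n => by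
    induction n with
    | zero => simpa using h0
    | succ n ih => simpa [Ordinal.toZFSet_add_one] using hs _ ih
  have := hν.eventually_forall_mem hκ hc
    (P := fun a b => ∀ n : ℕ, (n : Ordinal.{u}).toZFSet = a → P n b) fun a _ => by
      by_cases ha : ∃ n : ℕ, (n : Ordinal.{u}).toZFSet = a
      · obtain ⟨n, rfl⟩ := ha
        filter_upwards [h n] with b hb m hm
        have : (m : Ordinal.{u}) = n := Ordinal.toZFSet_injective hm
        rwa [Nat.cast_injective this]
      · exact Eventually.of_forall fun b n hn => (ha ⟨n, hn⟩).elim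
  exact this.mono fun b hb n => hb _ (hnat n) n rfl

theorem empty_mem (hκ : κ.IsOrdinal) (hν : NormalMeas κ ν) : ∅ ∈ κ := by
  obtain ⟨c, hc, h0, -⟩ := hν.exists_limit hκ
  exact hκ.mem_trans h0 hc

theorem exists_pairing (hκ : κ.IsOrdinal) (hν : NormalMeas κ ν) :
    ∃ e : ZFSet.{u} → ZFSet.{u} → ZFSet.{u}, (∀ a ∈ κ, ∀ b ∈ κ, e a b ∈ κ) ∧
      ∀ a ∈ κ, ∀ b ∈ κ, ∀ a' ∈ κ, ∀ b' ∈ κ, e a b = e a' b' → a = a' ∧ b = b' := by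
  classical
  have hnat : ∀ n : ℕ, (n : Ordinal.{u}).toZFSet ∈ κ := fun n => by
    induction n with
    | zero => simpa using hν.empty_mem hκ
    | succ n ih => simpa [Ordinal.toZFSet_add_one] using hν.succ_mem hκ ih
  have : Infinite κ := Infinite.of_injective (fun n : ℕ => (⟨_, hnat n⟩ : κ)) fun m n h =>
    Nat.cast_injective (Ordinal.toZFSet_injective (congrArg Subtype.val h))
  have hc := Cardinal.mul_eq_self (Cardinal.aleph0_le_mk κ)
  rw [Cardinal.mul_def] at hc
  obtain ⟨f⟩ := Cardinal.eq.1 hc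
  refine ⟨fun a b => if h : a ∈ κ ∧ b ∈ κ then f (⟨a, h.1⟩, ⟨b, h.2⟩) else ∅,
    fun a ha b hb => ?_, fun a ha b hb a' ha' b' hb' h => ?_⟩
  · simp [ha, hb]
  · simpa [ha, hb, ha', hb'] using h

theorem rank_collapse_lt (hκ : κ.IsOrdinal) (hν : NormalMeas κ ν) {c : ZFSet.{u}} (hc : c ∈ κ)
    {r : ZFSet.{u} → ZFSet.{u} → Prop} (hr : ∀ a b, r a b → a ∈ c) (x : ZFSet.{u}) :
    (collapse r x : ZFSet.{u}).rank < κ.rank := by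
  by_cases hwf : WellFounded r ∧ ∀ x, Small.{u} {y // r y x}
  · induction x using hwf.1.induction with
    | _ x ih =>
      have : ∀ a, ∃ d, r a x → d ∈ κ ∧ (collapse r a : ZFSet.{u}).rank ≤ d.rank := fun a => by
        by_cases ha : r a x
        · obtain ⟨d, hd⟩ := ZFSet.lt_rank_iff.1 (ih a ha)
          exact ⟨d, fun _ => hd⟩
        · exact ⟨∅, fun h => (ha h).elim⟩
      choose d hd using this
      obtain ⟨b, hb, hbκ⟩ := ((hν.eventually_forall_mem hκ hc (P := fun a b => r a x → d a ∈ b)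
        fun a _ => by
          by_cases ha : r a x
          · exact (hν.eventually_tail (hd a ha).1).mono fun b hb _ => hb
          · exact Eventually.of_forall fun b h => (ha h).elim).and hν.eventually_mem).exists
      refine lt_of_le_of_lt (ZFSet.rank_le_iff.2 fun {z} hz => ?_) (ZFSet.rank_lt_of_mem hbκ)
      obtain ⟨a, ha, rfl⟩ := (mem_collapse hwf.1 hwf.2).1 hz
      exact (hd a ha).2.trans_lt (ZFSet.rank_lt_of_mem (hb a (hr a x ha) ha))
  · rw [collapse, dif_neg hwf]
    exact ZFSet.rank_lt_of_mem (hν.empty_mem hκ)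

end NormalMeas

end LaverDiamond

namespace LaverDiamond

namespace NormalMeas

open Filter FirstOrder.Language

variable {κ ν : ZFSet.{u}}

instance : Nonempty (V : Set ZFSet.{u}) := ⟨⟨∅, mem_V _⟩⟩

/-- The ultrapower of the universe by a normal measure. -/
abbrev Ult (hν : NormalMeas κ ν) : Type (u + 1) :=
  (hν.uf : Filter ZFSet.{u}).Product fun _ => (V : Set ZFSet.{u})

/-- The class of a function in the ultrapower. -/
def cls (hν : NormalMeas κ ν) (f : ZFSet.{u} → ZFSet.{u}) : hν.Ult :=
  Quotient.mk _ fun b => ⟨f b, mem_V _⟩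

theorem cls_eq_iff (hν : NormalMeas κ ν) {f g : ZFSet.{u} → ZFSet.{u}} :
    hν.cls f = hν.cls g ↔ ∀ᶠ b in (hν.uf : Filter ZFSet.{u}), f b = g b := by
  refine Quotient.eq''.trans ?_
  exact eventually_congr (Eventually.of_forall fun b => Subtype.ext_iff)

theorem exists_cls (hν : NormalMeas κ ν) (q : hν.Ult) : ∃ f, hν.cls f = q := by
  obtain ⟨f, rfl⟩ := Quotient.exists_rep q
  exact ⟨fun b => f b, rfl⟩

/-- The membership relation of the ultrapower. -/
def memU (hν : NormalMeas κ ν) (q p : hν.Ult) : Prop :=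
  ∃ f g, hν.cls f = q ∧ hν.cls g = p ∧ ∀ᶠ b in (hν.uf : Filter ZFSet.{u}), f b ∈ g b

theorem memU_cls (hν : NormalMeas κ ν) {f g : ZFSet.{u} → ZFSet.{u}} :
    hν.memU (hν.cls f) (hν.cls g) ↔ ∀ᶠ b in (hν.uf : Filter ZFSet.{u}), f b ∈ g b := by
  refine ⟨?_, fun h => ⟨f, g, rfl, rfl, h⟩⟩
  rintro ⟨f', g', hf, hg, h⟩
  filter_upwards [hν.cls_eq_iff.1 hf, hν.cls_eq_iff.1 hg, h] with b h1 h2 h3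
  rwa [← h1, ← h2]

theorem relMap_iff (hν : NormalMeas κ ν) (x : Fin 2 → hν.Ult) :
    Structure.RelMap (L := SetLang) (memRel.mem : SetLang.Relations 2) x ↔
      hν.memU (x 0) (x 1) := by
  choose f hf using fun i => hν.exists_cls (x i)
  obtain rfl : (fun i => hν.cls (f i)) = x := funext hf
  rw [hν.memU_cls]
  exact relMap_quotient_mk' (s := Filter.productSetoid _ _) _ _

theorem wellFounded_memU (hκ : κ.IsOrdinal) (hν : NormalMeas κ ν) : WellFounded hν.memU := by
  rw [wellFounded_iff_isEmpty_descending_chain]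
  refine ⟨fun ⟨s, hs⟩ => ?_⟩
  choose f hf using fun i => hν.exists_cls (s i)
  obtain rfl : (fun i => hν.cls (f i)) = s := funext hf
  obtain ⟨b, hb⟩ := (hν.eventually_forall_nat hκ fun n => hν.memU_cls.1 (hs n)).exists
  exact (wellFounded_iff_isEmpty_descending_chain.1 ZFSet.mem_wf).false ⟨fun n => f n b, hb⟩

theorem small_memU (hν : NormalMeas κ ν) (p : hν.Ult) : Small.{u} {q // hν.memU q p} := by
  classical
  obtain ⟨g, rfl⟩ := hν.exists_cls p
  let Y : ZFSet.{u} := insert ∅ (ZFSet.sUnion (ZFSet.range fun b : κ => g b))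
  let F : (κ → Y) → hν.Ult :=
    fun h => hν.cls fun b => if hb : b ∈ κ then (h ⟨b, hb⟩ : ZFSet.{u}) else ∅
  have hsub : {q | hν.memU q (hν.cls g)} ⊆ Set.range F := by
    intro q hq
    obtain ⟨f, rfl⟩ := hν.exists_cls q
    refine ⟨fun b => if hb : f b ∈ g b then ⟨f b, ?_⟩ else ⟨∅, ?_⟩, ?_⟩
    · exact ZFSet.mem_insert_of_mem _
        (ZFSet.mem_sUnion.2 ⟨g b, ZFSet.mem_range.2 ⟨b, rfl⟩, hb⟩)
    · exact ZFSet.mem_insert _ _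
    · refine hν.cls_eq_iff.2 ?_
      filter_upwards [hν.memU_cls.1 hq, hν.eventually_mem] with b hb hbκ
      simp [hbκ, hb]
  exact small_subset hsub

theorem memU_ext (hν : NormalMeas κ ν) (p q : hν.Ult)
    (h : ∀ r, hν.memU r p ↔ hν.memU r q) : p = q := by
  obtain ⟨f, rfl⟩ := hν.exists_cls p
  obtain ⟨g, rfl⟩ := hν.exists_cls q
  have key : ∀ f g : ZFSet.{u} → ZFSet.{u},
      (∀ r, hν.memU r (hν.cls f) → hν.memU r (hν.cls g)) →
      ∀ᶠ b in (hν.uf : Filter ZFSet.{u}), f b ⊆ g b := by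
    intro f g h
    have : ∀ b, ∃ z, ¬ f b ⊆ g b → z ∈ f b ∧ z ∉ g b := fun b => by
      by_cases hb : f b ⊆ g b
      · exact ⟨∅, fun h => (h hb).elim⟩
      · obtain ⟨z, hz⟩ := Set.not_subset.1 hb
        exact ⟨z, fun _ => hz⟩
    choose k hk using this
    by_contra hn
    rw [← Ultrafilter.eventually_not] at hn
    obtain ⟨b, hb, hb'⟩ := ((hν.memU_cls.1 (h _ (hν.memU_cls.2
      (hn.mono fun b hb => (hk b hb).1)))).and hn).exists
    exact (hk b hb').2 hb
  refine hν.cls_eq_iff.2 ?_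
  filter_upwards [key f g fun r => (h r).1, key g f fun r => (h r).2] with b h1 h2
  exact ZFSet.ext fun z => ⟨@h1 z, @h2 z⟩

/-- The set represented by a function in the transitive collapse of the ultrapower. -/
noncomputable def val (hν : NormalMeas κ ν) (f : ZFSet.{u} → ZFSet.{u}) : ZFSet.{u} :=
  collapse hν.memU (hν.cls f)

theorem val_mem_iff (hκ : κ.IsOrdinal) (hν : NormalMeas κ ν) {f g : ZFSet.{u} → ZFSet.{u}} :
    hν.val f ∈ hν.val g ↔ ∀ᶠ b in (hν.uf : Filter ZFSet.{u}), f b ∈ g b :=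
  (collapse_mem_iff (hν.wellFounded_memU hκ) hν.small_memU hν.memU_ext).trans hν.memU_cls

theorem val_eq_iff (hκ : κ.IsOrdinal) (hν : NormalMeas κ ν) {f g : ZFSet.{u} → ZFSet.{u}} :
    hν.val f = hν.val g ↔ ∀ᶠ b in (hν.uf : Filter ZFSet.{u}), f b = g b :=
  (collapse_injective (hν.wellFounded_memU hκ) hν.small_memU hν.memU_ext).eq_iff.trans
    hν.cls_eq_iff

theorem mem_val (hκ : κ.IsOrdinal) (hν : NormalMeas κ ν) {g : ZFSet.{u} → ZFSet.{u}}
    {z : ZFSet.{u}} : z ∈ hν.val g ↔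
      ∃ f, (∀ᶠ b in (hν.uf : Filter ZFSet.{u}), f b ∈ g b) ∧ hν.val f = z := by
  rw [val, mem_collapse (hν.wellFounded_memU hκ) hν.small_memU]
  constructor
  · rintro ⟨q, hq, rfl⟩
    obtain ⟨f, rfl⟩ := hν.exists_cls q
    exact ⟨f, hν.memU_cls.1 hq, rfl⟩
  · rintro ⟨f, hf, rfl⟩
    exact ⟨_, hν.memU_cls.2 hf, rfl⟩

theorem val_const (hκ : κ.IsOrdinal) (hν : NormalMeas κ ν) {a : ZFSet.{u}} (ha : a ∈ κ) :
    hν.val (fun _ => a) = a := by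
  induction a using ZFSet.inductionOn with
  | _ a ih =>
    ext z
    rw [hν.mem_val hκ]
    constructor
    · rintro ⟨f, hf, rfl⟩
      obtain ⟨c, -, hc⟩ := hν.exists_eventually_eq (f := f) (by
        filter_upwards [hf, hν.eventually_tail ha, hν.eventually_mem] with b h1 h2 h3
        exact (hκ.mem h3).mem_trans h1 h2)
      obtain ⟨b, hb, hb'⟩ := (hc.and hf).exists
      rw [hb] at hb'
      rwa [(hν.val_eq_iff hκ).2 hc, ih c hb' (hκ.mem_trans hb' ha)]
    · exact fun hz => ⟨fun _ => z, Eventually.of_forall fun _ => hz,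
        ih z hz (hκ.mem_trans hz ha)⟩

theorem val_id (hκ : κ.IsOrdinal) (hν : NormalMeas κ ν) : hν.val (fun b => b) = κ := by
  ext z
  rw [hν.mem_val hκ]
  constructor
  · rintro ⟨f, hf, rfl⟩
    obtain ⟨c, hcκ, hc⟩ := hν.exists_eventually_eq hf
    rwa [(hν.val_eq_iff hκ).2 hc, hν.val_const hκ hcκ]
  · exact fun hz => ⟨fun _ => z, hν.eventually_tail hz, hν.val_const hκ hz⟩

theorem val_upair (hκ : κ.IsOrdinal) (hν : NormalMeas κ ν) (f g : ZFSet.{u} → ZFSet.{u}) :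
    hν.val (fun b => {f b, g b}) = {hν.val f, hν.val g} := by
  ext z
  rw [hν.mem_val hκ, ZFSet.mem_pair]
  constructor
  · rintro ⟨k, hk, rfl⟩
    simp only [ZFSet.mem_pair] at hk
    rw [hν.val_eq_iff hκ, hν.val_eq_iff hκ]
    exact Ultrafilter.eventually_or.1 hk
  · rintro (rfl | rfl)
    · exact ⟨f, Eventually.of_forall fun b => ZFSet.mem_pair.2 (Or.inl rfl), rfl⟩
    · exact ⟨g, Eventually.of_forall fun b => ZFSet.mem_pair.2 (Or.inr rfl), rfl⟩

theorem val_pair (hκ : κ.IsOrdinal) (hν : NormalMeas κ ν) (f g : ZFSet.{u} → ZFSet.{u}) :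
    hν.val (fun b => ZFSet.pair (f b) (g b)) = ZFSet.pair (hν.val f) (hν.val g) := by
  simp only [ZFSet.pair]
  rw [hν.val_upair hκ, hν.val_upair hκ]
  congr 1
  simpa only [ZFSet.pair_eq_singleton] using hν.val_upair hκ f f

/-- The transitive collapse of the ultrapower, as an isomorphism onto its image. -/
noncomputable def collapseEquiv (hκ : κ.IsOrdinal) (hν : NormalMeas κ ν) :
    SetLang.Equiv hν.Ult (Set.range (collapse hν.memU : hν.Ult → ZFSet.{u})) where
  toEquiv := Equiv.ofInjective _
    (collapse_injective (hν.wellFounded_memU hκ) hν.small_memU hν.memU_ext)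
  map_fun' f := f.elim
  map_rel' {n} r x := by
    cases r
    refine Iff.trans ?_ (hν.relMap_iff x).symm
    exact collapse_mem_iff (hν.wellFounded_memU hκ) hν.small_memU hν.memU_ext

/-- The ultrapower embedding by a normal measure. -/
noncomputable def measEmb (hκ : κ.IsOrdinal) (hν : NormalMeas κ ν) : MeasEmb κ where
  M := Set.range (collapse hν.memU)
  trans := by
    rintro _ ⟨q, rfl⟩ y hy
    obtain ⟨p, -, rfl⟩ := (mem_collapse (hν.wellFounded_memU hκ) hν.small_memU).1 hy
    exact ⟨p, rfl⟩
  e :=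
    { j := fun x => hν.val fun _ => x
      maps := fun x _ => ⟨hν.cls fun _ => x, rfl⟩
      elem := fun {n} φ v hv => by
        have h1 := Ultraproduct.realize_formula_cast (u := hν.uf)
          (M := fun _ => (V : Set ZFSet.{u})) φ fun i _ => ⟨v i, hv i⟩
        rw [Filter.eventually_const] at h1
        exact h1.symm.trans (StrongHomClass.realize_formula (hν.collapseEquiv hκ) φ).symm }
  crit := by
    refine ⟨hκ, ?_, fun a _ ha => hν.val_const hκ ha⟩
    have h := (hν.val_mem_iff hκ (f := fun b => b) (g := fun _ => κ)).2 hν.eventually_mem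
    rwa [hν.val_id hκ] at h

end NormalMeas

end LaverDiamond

namespace LaverDiamond

open Filter

/-- The relation on `c` coded by the subset `B` of `c` through the pairing function `e`. -/
def codedRel (e : ZFSet.{u} → ZFSet.{u} → ZFSet.{u}) (B c a b : ZFSet.{u}) : Prop :=
  a ∈ c ∧ b ∈ c ∧ e a b ∈ c ∧ e a b ∈ B

theorem small_codedRel (e : ZFSet.{u} → ZFSet.{u} → ZFSet.{u}) (B c x : ZFSet.{u}) :
    Small.{u} {y // codedRel e B c y x} :=
  have : Small.{u} {y | y ∈ c} := inferInstanceAs (Small.{u} c)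
  small_subset (t := {y | codedRel e B c y x}) (s := {y | y ∈ c}) fun _ hy => hy.1

/-- The codes of the membership relation on `t`, transported to `κ` along `i`. -/
noncomputable def code (e : ZFSet.{u} → ZFSet.{u} → ZFSet.{u}) (i : ZFSet.{u} → ZFSet.{u})
    (κ t : ZFSet.{u}) : ZFSet.{u} :=
  ZFSet.sep (fun c => ∃ x ∈ t, ∃ y ∈ t, x ∈ y ∧ c = e (i x) (i y)) κ

/-- The Laver function decoding the sets `S c` along the pairing function `e`. -/
noncomputable def decode (e : ZFSet.{u} → ZFSet.{u} → ZFSet.{u}) (S : ZFSet.{u} → ZFSet.{u})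
    (c : ZFSet.{u}) : ZFSet.{u} :=
  collapse (codedRel e (S c) c) ∅

theorem exists_injection {κ A t : ZFSet.{u}} (h0 : ∅ ∈ κ) (hA : A ∈ t)
    (ht : Cardinal.mk t.toSet ≤ Cardinal.mk κ.toSet) :
    ∃ i : ZFSet.{u} → ZFSet.{u}, (∀ x ∈ t, i x ∈ κ) ∧ Set.InjOn i {x | x ∈ t} ∧ i A = ∅ := by
  classical
  obtain ⟨f⟩ := ht
  let f' : ZFSet.{u} → ZFSet.{u} := fun x => if hx : x ∈ t then f ⟨x, hx⟩ else ∅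
  have hf' : ∀ x (hx : x ∈ t), f' x = f ⟨x, hx⟩ := fun x hx => dif_pos hx
  have hmem : ∀ x ∈ t, f' x ∈ κ := fun x hx => by rw [hf' x hx]; exact (f ⟨x, hx⟩).2
  refine ⟨fun x => Equiv.swap (f' A) ∅ (f' x), fun x hx => ?_, fun x hx y hy h => ?_,
    Equiv.swap_apply_left _ _⟩
  · change Equiv.swap (f' A) ∅ (f' x) ∈ κ
    rw [Equiv.swap_apply_def]
    split_ifs
    · exact h0
    · exact hmem A hA
    · exact hmem x hx
  · have := (Equiv.swap (f' A) ∅).injective h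
    rw [hf' x hx, hf' y hy] at this
    exact congrArg Subtype.val (f.injective (Subtype.ext this))

theorem mem_code {κ t : ZFSet.{u}} {e : ZFSet.{u} → ZFSet.{u} → ZFSet.{u}}
    {i : ZFSet.{u} → ZFSet.{u}} (he : ∀ a ∈ κ, ∀ b ∈ κ, e a b ∈ κ)
    (hinj : ∀ a ∈ κ, ∀ b ∈ κ, ∀ a' ∈ κ, ∀ b' ∈ κ, e a b = e a' b' → a = a' ∧ b = b')
    (hi : ∀ x ∈ t, i x ∈ κ) {a b : ZFSet.{u}} (ha : a ∈ κ) (hb : b ∈ κ) :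
    e a b ∈ code e i κ t ↔ ∃ x ∈ t, ∃ y ∈ t, x ∈ y ∧ a = i x ∧ b = i y := by
  rw [code, ZFSet.mem_sep]
  constructor
  · rintro ⟨-, x, hx, y, hy, hxy, h⟩
    exact ⟨x, hx, y, hy, hxy, hinj a ha b hb _ (hi x hx) _ (hi y hy) h⟩
  · rintro ⟨x, hx, y, hy, hxy, rfl, rfl⟩
    exact ⟨he _ ha _ hb, x, hx, y, hy, hxy, rfl⟩

theorem NormalMeas.val_collapse_codedRel {κ ν t : ZFSet.{u}} (hκ : κ.IsOrdinal)
    (hν : NormalMeas κ ν) (ht : t.IsTransitive) {e : ZFSet.{u} → ZFSet.{u} → ZFSet.{u}}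
    {i S : ZFSet.{u} → ZFSet.{u}} (he : ∀ a ∈ κ, ∀ b ∈ κ, e a b ∈ κ)
    (hinj : ∀ a ∈ κ, ∀ b ∈ κ, ∀ a' ∈ κ, ∀ b' ∈ κ, e a b = e a' b' → a = a' ∧ b = b')
    (hi : ∀ x ∈ t, i x ∈ κ) (hi' : Set.InjOn i {x | x ∈ t})
    (hS : ZFSet.sep (fun b => ∀ d ∈ b, d ∈ code e i κ t ↔ d ∈ S b) κ ∈ ν)
    {y : ZFSet.{u}} (hy : y ∈ t) :
    hν.val (fun b => collapse (codedRel e (S b) b) (i y)) = y := by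
  have hguess : ∀ᶠ b in (hν.uf : Filter ZFSet.{u}), ∀ a c, codedRel e (S b) b a c →
      ∃ x ∈ t, ∃ y ∈ t, x ∈ y ∧ a = i x ∧ c = i y := by
    filter_upwards [hν.eventually_iff.2 hS, hν.eventually_mem] with b hb hbκ a c ⟨ha, hc, h, h'⟩
    exact (mem_code he hinj hi (hκ.mem_trans ha hbκ) (hκ.mem_trans hc hbκ)).1 ((hb _ h).2 h')
  have hwf : ∀ᶠ b in (hν.uf : Filter ZFSet.{u}), WellFounded (codedRel e (S b) b) := by
    filter_upwards [hguess] with b hb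
    refine Subrelation.wf (r := InvImage (· ∈ ·) (Function.invFunOn i {x | x ∈ t}))
      (fun {a c} h => ?_) (InvImage.wf _ ZFSet.mem_wf)
    obtain ⟨x, hx, y, hy, hxy, rfl, rfl⟩ := hb a c h
    change Function.invFunOn i {x | x ∈ t} (i x) ∈ Function.invFunOn i {x | x ∈ t} (i y)
    rwa [hi'.leftInvOn_invFunOn hx, hi'.leftInvOn_invFunOn hy]
  induction y using ZFSet.inductionOn with
  | _ y ih =>
    ext z
    rw [hν.mem_val hκ]
    constructor
    · rintro ⟨f, hf, rfl⟩
      have : ∀ b, ∃ a, f b ∈ (collapse (codedRel e (S b) b) (i y) : ZFSet.{u}) →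
          WellFounded (codedRel e (S b) b) →
          codedRel e (S b) b a (i y) ∧ collapse (codedRel e (S b) b) a = f b := fun b => by
        by_cases hb : f b ∈ (collapse (codedRel e (S b) b) (i y) : ZFSet.{u}) ∧
          WellFounded (codedRel e (S b) b)
        · obtain ⟨a, ha⟩ := (mem_collapse hb.2 (small_codedRel e (S b) b)).1 hb.1
          exact ⟨a, fun _ _ => ha⟩
        · exact ⟨∅, fun h h' => (hb ⟨h, h'⟩).elim⟩
      choose g hg using this
      have hg' : ∀ᶠ b in (hν.uf : Filter ZFSet.{u}), codedRel e (S b) b (g b) (i y) ∧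
          collapse (codedRel e (S b) b) (g b) = f b := by
        filter_upwards [hf, hwf] with b h1 h2 using hg b h1 h2
      obtain ⟨c, -, hc⟩ := hν.exists_eventually_eq (hg'.mono fun b hb => hb.1.1)
      obtain ⟨b, ⟨hb, hgb⟩, hcb⟩ := ((hguess.and hg').and hc).exists
      obtain ⟨x, hx, y', hy', hxy, hxc, hyy⟩ := hb _ _ hgb.1
      obtain rfl := hi' hy hy' hyy
      rw [hcb] at hxc
      have : hν.val f = hν.val fun b => collapse (codedRel e (S b) b) (i x) := by
        rw [hν.val_eq_iff hκ]
        filter_upwards [hg', hc] with b h1 h2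
        rw [← h1.2, h2, hxc]
      rwa [this, ih x hxy hx]
    · intro hz
      have hzt : z ∈ t := ht y hy hz
      refine ⟨_, ?_, ih z hz hzt⟩
      have hcode := (mem_code he hinj hi (hi z hzt) (hi y hy)).2 ⟨z, hzt, y, hy, hz, rfl, rfl⟩
      filter_upwards [hwf, hν.eventually_iff.2 hS, hν.eventually_tail (hi z hzt),
        hν.eventually_tail (hi y hy), hν.eventually_tail (he _ (hi z hzt) _ (hi y hy))]
        with b h1 h2 h3 h4 h5
      exact collapse_mem h1 (small_codedRel e (S b) b) ⟨h3, h4, h5, (h2 _ h5).1 hcode⟩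

end LaverDiamond

/-- If `κ` is `μ`-measurable, i.e. there is an elementary embedding `j : V → M` with
critical point `κ` such that the induced normal measure `μ = {X ⊆ κ : κ ∈ j(X)}` is an
element of `M`, then `LD^meas_κ` holds. -/
theorem LDmeas_of_muMeasurable (κ : ZFSet.{u})
    (h : ∃ E : MeasEmb κ, ∃ μ : ZFSet, μ ∈ E.M ∧
      ∀ X : ZFSet, X ∈ μ ↔ X ⊆ κ ∧ κ ∈ E.e.j X) :
    LDmeas κ := by
  obtain ⟨E, μ, hμM, hμ⟩ := h
  have hκ := E.crit.1
  obtain ⟨S, hS⟩ := exists_guessing_sequence E hμM hμ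
  obtain ⟨ν₀, hν₀, -⟩ := hS ∅ (ZFSet.empty_subset κ)
  obtain ⟨e, he, hinj⟩ := hν₀.exists_pairing hκ
  refine ⟨ZFSet.range fun c : κ => ZFSet.pair c (decode e S c), ⟨fun p hp => ?_, ?_⟩, ?_⟩
  · obtain ⟨c, rfl⟩ := ZFSet.mem_range.1 hp
    exact ⟨c, _, c.2, hν₀.rank_collapse_lt hκ c.2 (fun a b hab => hab.1) ∅, rfl⟩
  · intro c A B hA hB
    obtain ⟨c₁, h₁⟩ := ZFSet.mem_range.1 hA
    obtain ⟨c₂, h₂⟩ := ZFSet.mem_range.1 hB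
    rw [ZFSet.pair_inj] at h₁ h₂
    rw [← h₁.2, ← h₂.2, h₁.1, h₂.1]
  · rintro A ⟨t, ht, hA, hcard⟩
    obtain ⟨i, hi, hi', hiA⟩ := exists_injection (hν₀.empty_mem hκ) hA hcard
    obtain ⟨ν, hν, hguess⟩ := hS (code e i κ t) ZFSet.sep_subset
    refine ⟨hν.measEmb hκ, ?_⟩
    have hval := hν.val_collapse_codedRel hκ ht he hinj hi hi' hguess hA
    rw [hiA] at hval
    have hpair := hν.val_pair hκ (fun b => b) (decode e S)
    rw [hν.val_id hκ, show hν.val (decode e S) = A from hval] at hpair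
    rw [← hpair]
    refine (hν.val_mem_iff hκ).2 ?_
    filter_upwards [hν.eventually_mem] with b hb
    exact ZFSet.mem_range.2 ⟨⟨b, hb⟩, rfl⟩
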